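/- Let (a,b) ∈ ℝ/ℤ × [0,1]. If f_{a,b} has an attracting periodic orbit of period p ≥ 2 whose orbit avoids the classes of 0 and 1/2, then at least one point of the orbit lies in the interior of I_+; equivalently, there is no attracting periodic orbit of period at least 2 entirely contained in I_−. -/

import Mathlib

open Set Filter Topology

noncomputable section

/-- Representative of a point of the circle in `[0,1)`. -/
noncomputable def rep (z : UnitAddCircle) : ℝ := (AddCircle.equivIco 1 0 z).val

/-- The straight sine map on `[0,1)`. -/
noncomputable def Sfun (t : ℝ) : ℝ := if t ≤ 1/2 then 4*t - 1 else -4*t + 3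

/-- The piecewise linear perturbation of the doubling map. -/
noncomputable def plpdm (a : UnitAddCircle) (b : ℝ) (z : UnitAddCircle) : UnitAddCircle :=
  ((2 * rep z + (b/2) * Sfun (rep z) : ℝ) : UnitAddCircle) + a

/-- The doubling map. -/
def Dbl (z : UnitAddCircle) : UnitAddCircle := z + z

/-- `x` is an attracting periodic point of `f` of exact period `n`. -/
def IsAttractingPeriodicPt (f : UnitAddCircle → UnitAddCircle) (n : ℕ)
    (x : UnitAddCircle) : Prop :=
  0 < n ∧ f^[n] x = x ∧ (∀ m, 0 < m → m < n → f^[m] x ≠ x) ∧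
  ∃ U : Set UnitAddCircle, IsOpen U ∧ IsConnected U ∧ x ∈ U ∧ f^[n] '' U ⊆ U ∧
    ∀ y ∈ U, Tendsto (fun k => f^[n*k] y) atTop (nhds x)

/-- Forward orbit of `x` under `f`. -/
def orbitSet (f : UnitAddCircle → UnitAddCircle) (x : UnitAddCircle) : Set UnitAddCircle :=
  {y | ∃ i, f^[i] x = y}

/-- Basin of attraction of the set `O`. -/
def basin (f : UnitAddCircle → UnitAddCircle) (O : Set UnitAddCircle) : Set UnitAddCircle :=
  {y | Tendsto (fun k => Metric.infDist (f^[k] y) O) atTop (nhds 0)}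

/-- Immediate basin of attraction of the orbit `O`. -/
def immBasin (f : UnitAddCircle → UnitAddCircle) (O : Set UnitAddCircle) :
    Set UnitAddCircle :=
  ⋃ z ∈ O, connectedComponentIn (basin f O) z

/-- The hyperbolic set `H`. -/
def hypSet : Set (UnitAddCircle × ℝ) :=
  {q | q.2 ∈ Set.Ico (0:ℝ) 1 ∧ ∃ n x, IsAttractingPeriodicPt (plpdm q.1 q.2) n x}

/-- The lift `F_{a,b}` of `f_{a,b}`, normalized so that `F_{a,b}(0) ∈ [0,1)`. -/
noncomputable def liftF (a : UnitAddCircle) (b : ℝ) (x : ℝ) : ℝ :=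
  (2 * Int.fract x + rep a + (b/2) * Sfun (Int.fract x)
    + (if rep a - b/2 < 0 then 1 else 0)) + 2 * (⌊x⌋ : ℝ)

/-- `Φ_{a,b}`, the limit of `F_{a,b}^n(x)/2^n`. -/
noncomputable def Phi (a : UnitAddCircle) (b : ℝ) (x : ℝ) : ℝ :=
  limUnder atTop (fun n : ℕ => (liftF a b)^[n] x / 2 ^ n)

/-- The semiconjugacy `φ_{a,b}` induced by `Φ_{a,b}`. -/
noncomputable def phiMap (a : UnitAddCircle) (b : ℝ) (z : UnitAddCircle) : UnitAddCircle :=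
  ((Phi a b (rep z) : ℝ) : UnitAddCircle)

/-- The arc `I₊ = [0,1/2]` of the circle. -/
def Iplus : Set UnitAddCircle := (fun t : ℝ => (t : UnitAddCircle)) '' Set.Icc 0 (1/2)

/-- The arc `I₋ = [1/2,1]` of the circle. -/
def Iminus : Set UnitAddCircle := (fun t : ℝ => (t : UnitAddCircle)) '' Set.Icc (1/2) 1

/-- The orbit of `x` (of period `p`) avoids `0`, `1/2` and has slope itinerary `σ`,
where `σ j = true` encodes the symbol `−` and `σ j = false` encodes `+`. -/
def HasItinerary (f : UnitAddCircle → UnitAddCircle) (p : ℕ) (x : UnitAddCircle)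
    (σ : Fin p → Bool) : Prop :=
  (∀ j : Fin p, f^[(j : ℕ)] x ≠ (0 : UnitAddCircle) ∧
      f^[(j : ℕ)] x ≠ (((1:ℝ)/2 : ℝ) : UnitAddCircle)) ∧
  ∀ j : Fin p, (σ j = true → f^[(j : ℕ)] x ∈ Iminus) ∧ (σ j = false → f^[(j : ℕ)] x ∈ Iplus)

/-- The set `P_σ` of parameters whose attracting orbit has slope itinerary `σ`. -/
def paramSet (p : ℕ) (σ : Fin p → Bool) : Set (UnitAddCircle × ℝ) :=
  {q | q.2 ∈ Set.Ico (0:ℝ) 1 ∧ ∃ x, IsAttractingPeriodicPt (plpdm q.1 q.2) p x ∧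
       HasItinerary (plpdm q.1 q.2) p x σ}

/-- `S` is a tongue: its closure meets `ℝ/ℤ × {1}` in a nondegenerate interval. -/
def IsTongue (S : Set (UnitAddCircle × ℝ)) : Prop :=
  ∃ u v : ℝ, u < v ∧ ∀ t ∈ Set.Icc u v, (((t : ℝ) : UnitAddCircle), (1:ℝ)) ∈ closure S

end

theorem coe_rep (z : UnitAddCircle) : ((rep z : ℝ) : UnitAddCircle) = z :=
  (AddCircle.equivIco (1 : ℝ) 0).symm_apply_apply z

theorem rep_nonneg (z : UnitAddCircle) : 0 ≤ rep z :=
  (AddCircle.equivIco (1 : ℝ) 0 z).2.1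

theorem rep_lt_one (z : UnitAddCircle) : rep z < 1 := by
  simpa [rep] using (AddCircle.equivIco (1 : ℝ) 0 z).2.2

theorem rep_coe {t : ℝ} (h0 : 0 ≤ t) (h1 : t < 1) : rep (t : UnitAddCircle) = t := by
  have h : t ∈ Set.Ico (0 : ℝ) (0 + 1) := ⟨h0, by linarith⟩
  have := (AddCircle.equivIco (1 : ℝ) 0).apply_symm_apply ⟨t, h⟩
  exact congrArg Subtype.val this

/-- Every point of the circle lifts to a real of absolute value equal to its norm. -/
theorem exists_coe_eq_abs_eq_norm (z : UnitAddCircle) :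
    ∃ d : ℝ, (d : UnitAddCircle) = z ∧ |d| = ‖z‖ := by
  let w := AddCircle.equivIco (1 : ℝ) (-1 / 2) z
  have hw : ((w : ℝ) : UnitAddCircle) = z :=
    (AddCircle.equivIco (1 : ℝ) (-1 / 2)).symm_apply_apply z
  refine ⟨w, hw, ?_⟩
  rw [← hw, eq_comm]
  apply (AddCircle.norm_coe_eq_abs_iff (1 : ℝ) one_ne_zero).2
  have h1 := w.2.1
  have h2 := w.2.2
  rw [abs_le]
  norm_num at h1 h2 ⊢
  constructor <;> linarith

theorem norm_coe_eq_abs {d : ℝ} (hd : |d| ≤ 1 / 2) : ‖(d : UnitAddCircle)‖ = |d| :=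
  (AddCircle.norm_coe_eq_abs_iff (1 : ℝ) one_ne_zero).2 (by simpa using hd)

theorem coe_eq_coe_iff_exists_int {s t : ℝ} :
    (s : UnitAddCircle) = t ↔ ∃ n : ℤ, s = t + n := by
  rw [← sub_eq_zero, ← AddCircle.coe_sub, AddCircle.coe_eq_zero_iff]
  constructor
  · rintro ⟨n, hn⟩
    exact ⟨n, by simp at hn; linarith⟩
  · rintro ⟨n, hn⟩
    exact ⟨n, by simp [hn]⟩

theorem rep_gt_half_of_notMem_interior_Iplus {z : UnitAddCircle} (h0 : z ≠ 0)
    (h1 : z ≠ (((1 : ℝ) / 2 : ℝ) : UnitAddCircle)) (hz : z ∉ interior Iplus) :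
    1 / 2 < rep z := by
  by_contra! hle
  have hne0 : rep z ≠ 0 := fun h => h0 (by rw [← coe_rep z, h]; rfl)
  have hne1 : rep z ≠ 1 / 2 := fun h => h1 (by rw [← h, coe_rep])
  apply hz
  have hopen : IsOpen ((fun t : ℝ => (t : UnitAddCircle)) '' Set.Ioo 0 (1 / 2)) :=
    QuotientAddGroup.isOpenMap_coe _ isOpen_Ioo
  refine interior_maximal (Set.image_mono Set.Ioo_subset_Icc_self) hopen
    ⟨rep z, ⟨lt_of_le_of_ne (rep_nonneg z) hne0.symm, lt_of_le_of_ne hle hne1⟩, coe_rep z⟩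

theorem plpdm_of_rep_gt_half (a : UnitAddCircle) (b : ℝ) {z : UnitAddCircle}
    (hz : 1 / 2 < rep z) :
    plpdm a b z = (((2 - 2 * b) * rep z + 3 / 2 * b + rep a : ℝ) : UnitAddCircle) := by
  rw [AddCircle.coe_add, coe_rep, plpdm, Sfun, if_neg (not_le.2 hz)]
  congr 2
  ring

/-- Locally at a point of the open arc `(1/2, 1)` the map is affine of slope `2 - 2b`. -/
theorem exists_plpdm_add_coe (a : UnitAddCircle) (b : ℝ) {z : UnitAddCircle}
    (hz : 1 / 2 < rep z) :
    ∃ δ > 0, ∀ d : ℝ, |d| < δ →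
      plpdm a b (z + (d : UnitAddCircle)) =
        plpdm a b z + (((2 - 2 * b) * d : ℝ) : UnitAddCircle) := by
  refine ⟨min (rep z - 1 / 2) (1 - rep z),
    lt_min (by linarith) (by linarith [rep_lt_one z]), fun d hd => ?_⟩
  obtain ⟨h1, h2⟩ := lt_min_iff.1 hd
  rw [abs_lt] at h1 h2
  have hrep : rep (z + (d : UnitAddCircle)) = rep z + d := by
    conv_lhs => rw [← coe_rep z, ← AddCircle.coe_add]
    exact rep_coe (by linarith) (by linarith)
  rw [plpdm_of_rep_gt_half a b hz, plpdm_of_rep_gt_half a b (by rw [hrep]; linarith), hrep,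
    ← AddCircle.coe_add]
  congr 1
  ring

theorem exists_iterate_plpdm_add_coe (a : UnitAddCircle) {b : ℝ} (hb : b < 1)
    {x : UnitAddCircle} (hx : ∀ j : ℕ, 1 / 2 < rep ((plpdm a b)^[j] x)) (n : ℕ) :
    ∃ δ > 0, ∀ d : ℝ, |d| < δ →
      (plpdm a b)^[n] (x + (d : UnitAddCircle)) =
        (plpdm a b)^[n] x + (((2 - 2 * b) ^ n * d : ℝ) : UnitAddCircle) := by
  induction n with
  | zero => exact ⟨1, one_pos, fun d _ => by simp⟩
  | succ n ih =>
    obtain ⟨δ, hδ, h⟩ := ih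
    obtain ⟨η, hη, h'⟩ := exists_plpdm_add_coe a b (hx n)
    have hs : 0 < (2 - 2 * b) ^ n := pow_pos (by linarith) n
    refine ⟨min δ (η / (2 - 2 * b) ^ n), lt_min hδ (div_pos hη hs), fun d hd => ?_⟩
    obtain ⟨h1, h2⟩ := lt_min_iff.1 hd
    rw [Function.iterate_succ_apply', h d h1, h', Function.iterate_succ_apply']
    · congr 2
      ring
    · rw [abs_mul, abs_of_pos hs, mul_comm]
      exact (lt_div_iff₀ hs).1 h2

theorem countable_plpdm_fiber (a : UnitAddCircle) {b : ℝ} (hb0 : 0 ≤ b) (hb : b < 1)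
    (w : UnitAddCircle) : (plpdm a b ⁻¹' {w}).Countable := by
  have h1 := Set.countable_range (fun n : ℤ =>
    (((rep (w - a) + n + b / 2) / (2 + 2 * b) : ℝ) : UnitAddCircle))
  have h2 := Set.countable_range (fun n : ℤ =>
    (((rep (w - a) + n - 3 / 2 * b) / (2 - 2 * b) : ℝ) : UnitAddCircle))
  refine (h1.union h2).mono fun z hz => ?_
  have hz' : ((2 * rep z + (b / 2) * Sfun (rep z) : ℝ) : UnitAddCircle)
      = (rep (w - a) : ℝ) := by
    rw [coe_rep]
    exact eq_sub_of_add_eq hz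
  obtain ⟨n, hn⟩ := coe_eq_coe_iff_exists_int.1 hz'
  unfold Sfun at hn
  split_ifs at hn
  · refine Or.inl ⟨n, ?_⟩
    conv_rhs => rw [← coe_rep z]
    have : 2 + 2 * b ≠ 0 := by linarith
    simp only
    congr 1
    rw [div_eq_iff this]
    linarith
  · refine Or.inr ⟨n, ?_⟩
    conv_rhs => rw [← coe_rep z]
    have : 2 - 2 * b ≠ 0 := by linarith
    simp only
    congr 1
    rw [div_eq_iff this]
    linarith

theorem countable_iterate_plpdm_fiber (a : UnitAddCircle) {b : ℝ} (hb0 : 0 ≤ b) (hb : b < 1)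
    (w : UnitAddCircle) (n : ℕ) : ((plpdm a b)^[n] ⁻¹' {w}).Countable := by
  induction n with
  | zero => simp
  | succ n ih =>
    have : (plpdm a b)^[n + 1] ⁻¹' {w} =
        ⋃ v ∈ (plpdm a b)^[n] ⁻¹' {w}, plpdm a b ⁻¹' {v} := by
      ext z
      simp
    rw [this]
    exact ih.biUnion fun v _ => countable_plpdm_fiber a hb0 hb v

/-- A nonempty open subset of the circle is not covered by a countable set. -/
theorem exists_mem_open_notMem_countable {U B : Set UnitAddCircle} (hU : IsOpen U)
    (hne : U.Nonempty) (hB : B.Countable) : ∃ y ∈ U, y ∉ B := by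
  have hB' : ((fun t : ℝ => (t : UnitAddCircle)) ⁻¹' B).Countable := by
    have : ((fun t : ℝ => (t : UnitAddCircle)) ⁻¹' B) ⊆
        ⋃ w ∈ B, Set.range (fun n : ℤ => rep w + n) := by
      intro t ht
      obtain ⟨n, hn⟩ := coe_eq_coe_iff_exists_int.1 (coe_rep (t : UnitAddCircle)).symm
      exact Set.mem_biUnion ht ⟨n, hn.symm⟩
    exact (hB.biUnion fun w _ => Set.countable_range _).mono this
  have hU' : IsOpen ((fun t : ℝ => (t : UnitAddCircle)) ⁻¹' U) :=
    hU.preimage (AddCircle.continuous_mk' 1)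
  obtain ⟨z, hz⟩ := hne
  obtain ⟨t, htU, htB⟩ := (hB'.dense_compl ℝ).inter_open_nonempty _ hU'
    ⟨rep z, by simpa [coe_rep] using hz⟩
  exact ⟨t, htU, htB⟩

/-- A periodic orbit in `(1/2, 1)` is repelling when the slope there exceeds one. -/
theorem half_le_of_isAttractingPeriodicPt {a : UnitAddCircle} {b : ℝ} (hb0 : 0 ≤ b)
    {p : ℕ} {x : UnitAddCircle} (hx : IsAttractingPeriodicPt (plpdm a b) p x)
    (hrep : ∀ j : ℕ, 1 / 2 < rep ((plpdm a b)^[j] x)) : 1 / 2 ≤ b := by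
  by_contra! hb
  obtain ⟨-, hper, -, U, hUo, -, hxU, -, hconv⟩ := hx
  have hb1 : b < 1 := by linarith
  obtain ⟨y, hyU, hyB⟩ := exists_mem_open_notMem_countable hUo ⟨x, hxU⟩
    (Set.countable_iUnion fun k : ℕ => countable_iterate_plpdm_fiber a hb0 hb1 x (p * k))
  simp only [Set.mem_iUnion, Set.mem_preimage, Set.mem_singleton_iff, not_exists] at hyB
  obtain ⟨δ, hδ, hloc⟩ := exists_iterate_plpdm_add_coe a hb1 hrep p
  rw [hper] at hloc
  set f := plpdm a b
  set m := (2 - 2 * b) ^ p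
  have hm : 1 ≤ m := one_le_pow₀ (by linarith)
  have hm0 : 0 < m := by linarith
  let D : ℕ → ℝ := fun k => ‖f^[p * k] y - x‖
  have hD : Tendsto D atTop (𝓝 0) := tendsto_iff_norm_sub_tendsto_zero.1 (hconv y hyU)
  have hpos : ∀ k, 0 < D k := fun k => norm_pos_iff.2 (sub_ne_zero.2 (hyB k))
  have hstep : ∀ k, D k < δ → D k < 1 / 2 / m → D k ≤ D (k + 1) := by
    intro k h1 h2
    obtain ⟨d, hd, hdn⟩ := exists_coe_eq_abs_eq_norm (f^[p * k] y - x)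
    have hdD : |d| = D k := hdn
    have hval : f^[p * (k + 1)] y - x = ((m * d : ℝ) : UnitAddCircle) := by
      rw [mul_add, mul_one, add_comm, Function.iterate_add_apply,
        ← add_sub_cancel x (f^[p * k] y), ← hd, hloc d (by rwa [hdD]), add_sub_cancel_left]
    have habs : |m * d| = m * D k := by rw [abs_mul, abs_of_pos hm0, hdD]
    have hle : |m * d| ≤ 1 / 2 := by
      rw [habs, mul_comm]
      exact ((lt_div_iff₀ hm0).1 h2).le
    have : D (k + 1) = m * D k := by
      change ‖_‖ = _
      rw [hval, norm_coe_eq_abs hle, habs]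
    rw [this]
    exact le_mul_of_one_le_left (hpos k).le hm
  have hev : ∀ᶠ k in atTop, D k < δ ∧ D k < 1 / 2 / m :=
    (hD.eventually_lt_const hδ).and (hD.eventually_lt_const (by positivity))
  obtain ⟨K, hK⟩ := eventually_atTop.1 hev
  have hmono : ∀ k ≥ K, D K ≤ D k := by
    intro k hk
    induction k, hk using Nat.le_induction with
    | base => exact le_rfl
    | succ k hk ih => exact ih.trans (hstep k (hK k hk).1 (hK k hk).2)
  exact absurd (ge_of_tendsto hD (eventually_atTop.2 ⟨K, hmono⟩)) (not_le.2 (hpos K))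

/-- When the slope on `(1/2, 1)` is at most one, a periodic orbit there is a fixed point. -/
theorem plpdm_eq_self_of_periodic {a : UnitAddCircle} {b : ℝ} (hb : b ∈ Set.Icc (1 / 2 : ℝ) 1)
    {p : ℕ} (hp : 0 < p) {x : UnitAddCircle} (hper : (plpdm a b)^[p] x = x)
    (hrep : ∀ j : ℕ, 1 / 2 < rep ((plpdm a b)^[j] x)) : plpdm a b x = x := by
  obtain ⟨hb1, hb2⟩ := hb
  set f := plpdm a b with hf
  set s : ℝ := 2 - 2 * b
  let t : ℕ → ℝ := fun j => rep (f^[j] x)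
  have ht1 : ∀ j, 1 / 2 < t j := hrep
  have ht2 : ∀ j, t j < 1 := fun j => rep_lt_one _
  have hrec : ∀ j, ∃ n : ℤ, t (j + 1) = s * t j + 3 / 2 * b + rep a + n := by
    intro j
    apply coe_eq_coe_iff_exists_int.1
    rw [coe_rep, Function.iterate_succ_apply', hf, plpdm_of_rep_gt_half a b (hrep j)]
  choose n hn using hrec
  have hdiff : ∀ j, t (j + 2) - t (j + 1) = s * (t (j + 1) - t j) := by
    intro j
    have habs : |s * (t (j + 1) - t j)| ≤ 1 / 2 := by
      have h1 : |s| ≤ 1 := abs_le.2 ⟨by linarith, by linarith⟩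
      have h2 : |t (j + 1) - t j| ≤ 1 / 2 :=
        abs_le.2 ⟨by linarith [ht1 (j + 1), ht2 j], by linarith [ht1 j, ht2 (j + 1)]⟩
      rw [abs_mul]
      exact (mul_le_of_le_one_left (abs_nonneg _) h1).trans h2
    have e1 := hn j
    have e2 := hn (j + 1)
    rw [abs_le] at habs
    have b1 : ((n (j + 1) - n j : ℤ) : ℝ) < 1 := by
      push_cast
      linarith [ht1 (j + 1), ht2 (j + 1 + 1)]
    have b2 : (-1 : ℝ) < ((n (j + 1) - n j : ℤ) : ℝ) := by
      push_cast
      linarith [ht2 (j + 1), ht1 (j + 1 + 1)]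
    have b1' : n (j + 1) - n j < 1 := by exact_mod_cast b1
    have b2' : -1 < n (j + 1) - n j := by exact_mod_cast b2
    have heq : n (j + 1) = n j := by omega
    rw [heq] at e2
    linarith
  have hpow : ∀ j, t (j + 1) - t j = s ^ j * (t 1 - t 0) := by
    intro j
    induction j with
    | zero => simp
    | succ j ih => rw [hdiff, ih, pow_succ]; ring
  have hsum : (∑ j ∈ Finset.range p, s ^ j) * (t 1 - t 0) = 0 := by
    rw [Finset.sum_mul, ← Finset.sum_congr rfl fun j _ => hpow j, Finset.sum_range_sub]
    simp [t, hper]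
  have hsumpos : 0 < ∑ j ∈ Finset.range p, s ^ j := by
    refine lt_of_lt_of_le one_pos ?_
    have := Finset.single_le_sum (f := fun j => s ^ j)
      (fun j _ => pow_nonneg (by linarith : 0 ≤ s) j) (Finset.mem_range.2 hp)
    simpa using this
  have h01 : t 1 = t 0 :=
    sub_eq_zero.1 ((mul_eq_zero.1 hsum).resolve_left hsumpos.ne')
  calc f x = ((t 1 : ℝ) : UnitAddCircle) := (coe_rep _).symm
    _ = ((t 0 : ℝ) : UnitAddCircle) := by rw [h01]
    _ = x := coe_rep _

theorem stmt12 (a : UnitAddCircle) (b : ℝ) (hb : b ∈ Set.Icc (0:ℝ) 1)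
    (p : ℕ) (hp : 2 ≤ p) (x : UnitAddCircle)
    (hx : IsAttractingPeriodicPt (plpdm a b) p x)
    (havoid : ∀ j : ℕ, (plpdm a b)^[j] x ≠ (0 : UnitAddCircle) ∧
      (plpdm a b)^[j] x ≠ (((1:ℝ)/2 : ℝ) : UnitAddCircle)) :
    ∃ j : ℕ, (plpdm a b)^[j] x ∈ interior Iplus := by
  by_contra! hnot
  have hrep : ∀ j : ℕ, 1 / 2 < rep ((plpdm a b)^[j] x) := fun j =>
    rep_gt_half_of_notMem_interior_Iplus (havoid j).1 (havoid j).2 (hnot j)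
  have hb1 : 1 / 2 ≤ b := half_le_of_isAttractingPeriodicPt hb.1 hx hrep
  exact hx.2.2.1 1 one_pos (by omega)
    (plpdm_eq_self_of_periodic ⟨hb1, hb.2⟩ hx.1 hx.2.1 hrep)
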